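/- The space M(ℤ), endowed with the topology of pointwise convergence, is path-connected. -/

import Mathlib

/-- A multiplicative ring seminorm on `ℤ` bounded by the usual absolute value. -/
def IsBerkSeminorm (x : ℤ → ℝ) : Prop :=
  x 0 = 0 ∧ x 1 = 1 ∧ (∀ n, 0 ≤ x n) ∧ (∀ m n, x (m * n) = x m * x n) ∧
    (∀ m n, x (m + n) ≤ x m + x n) ∧ (∀ n : ℤ, x n ≤ |(n : ℝ)|)

/-- The Berkovich spectrum `M(ℤ)`, with the topology of pointwise convergence
(the subspace topology from the product topology on `ℤ → ℝ`). -/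
abbrev BerkZ : Type := {x : ℤ → ℝ // IsBerkSeminorm x}


theorem joined_of_family (f : unitInterval → ℤ → ℝ) (hf : ∀ t, IsBerkSeminorm (f t))
    (hc : ∀ n, Continuous fun t => f t n) :
    Joined (⟨f 0, hf 0⟩ : BerkZ) ⟨f 1, hf 1⟩ :=
  ⟨{ toFun := fun t => ⟨f t, hf t⟩
     continuous_toFun := (continuous_pi hc).subtype_mk _
     source' := rfl
     target' := rfl }⟩

/-- The trivial absolute value on `ℤ`. -/
def trivialSeminorm (n : ℤ) : ℝ := if n = 0 then 0 else 1

theorem one_le_abs_intCast {n : ℤ} (hn : n ≠ 0) : (1 : ℝ) ≤ |(n : ℝ)| := by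
  exact_mod_cast Int.one_le_abs hn

theorem isBerkSeminorm_trivialSeminorm : IsBerkSeminorm trivialSeminorm := by
  refine ⟨by simp [trivialSeminorm], by simp [trivialSeminorm], fun n => ?_, fun m n => ?_,
    fun m n => ?_, fun n => ?_⟩
  · unfold trivialSeminorm
    split_ifs <;> norm_num
  · by_cases hm : m = 0 <;> by_cases hn : n = 0 <;> simp [trivialSeminorm, hm, hn]
  · by_cases hm : m = 0
    · simp [trivialSeminorm, hm]
    · by_cases hn : n = 0
      · simp [trivialSeminorm, hn]
      · by_cases hmn : m + n = 0 <;> simp [trivialSeminorm, hm, hn, hmn]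
  · by_cases hn : n = 0
    · simp [trivialSeminorm, hn]
    · simpa [trivialSeminorm, hn] using one_le_abs_intCast hn

/-- The power `x ^ t` of a function on `ℤ`, with value `0` at `0` for every `t`. -/
noncomputable def powSeminorm (x : ℤ → ℝ) (t : ℝ) (n : ℤ) : ℝ := if n = 0 then 0 else x n ^ t

theorem isBerkSeminorm_powSeminorm {x : ℤ → ℝ} (hx : IsBerkSeminorm x) {t : ℝ}
    (ht₀ : 0 ≤ t) (ht₁ : t ≤ 1) : IsBerkSeminorm (powSeminorm x t) := by
  obtain ⟨-, h1, hnn, hmul, hadd, hle⟩ := hx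
  have hpos (n : ℤ) : 0 ≤ powSeminorm x t n := by
    unfold powSeminorm
    split_ifs
    · exact le_rfl
    · exact Real.rpow_nonneg (hnn n) t
  refine ⟨by simp [powSeminorm], by simp [powSeminorm, h1], hpos, fun m n => ?_,
    fun m n => ?_, fun n => ?_⟩
  · by_cases hm : m = 0 <;> by_cases hn : n = 0 <;> simp [powSeminorm, hm, hn]
    rw [hmul, Real.mul_rpow (hnn m) (hnn n)]
  · by_cases hm : m = 0
    · simp [powSeminorm, hm]
    by_cases hn : n = 0
    · simp [powSeminorm, hn]
    by_cases hmn : m + n = 0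
    · have : powSeminorm x t (m + n) = 0 := by simp [powSeminorm, hmn]
      rw [this]
      exact add_nonneg (hpos m) (hpos n)
    simp only [powSeminorm, hm, hn, hmn, if_false]
    exact (Real.rpow_le_rpow (hnn _) (hadd m n) ht₀).trans
      (Real.rpow_add_le_add_rpow (hnn m) (hnn n) ht₀ ht₁)
  · by_cases hn : n = 0
    · simp [powSeminorm, hn]
    simp only [powSeminorm, hn, if_false]
    calc x n ^ t ≤ |(n : ℝ)| ^ t := Real.rpow_le_rpow (hnn n) (hle n) ht₀
      _ ≤ |(n : ℝ)| ^ (1 : ℝ) := Real.rpow_le_rpow_of_exponent_le (one_le_abs_intCast hn) ht₁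
      _ = |(n : ℝ)| := Real.rpow_one _

/-- The function `n ↦ r ^ vₚ(n)`, with value `0` at `0`. -/
noncomputable def padicSeminorm (p : ℕ) (r : ℝ) (n : ℤ) : ℝ :=
  if n = 0 then 0 else r ^ padicValInt p n

theorem isBerkSeminorm_padicSeminorm (p : ℕ) [Fact p.Prime] {r : ℝ} (hr₀ : 0 ≤ r)
    (hr₁ : r ≤ 1) : IsBerkSeminorm (padicSeminorm p r) := by
  have hpos (n : ℤ) : 0 ≤ padicSeminorm p r n := by
    unfold padicSeminorm
    split_ifs
    · exact le_rfl
    · exact pow_nonneg hr₀ _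
  refine ⟨by simp [padicSeminorm], by simp [padicSeminorm], hpos, fun m n => ?_,
    fun m n => ?_, fun n => ?_⟩
  · by_cases hm : m = 0 <;> by_cases hn : n = 0 <;> simp [padicSeminorm, hm, hn]
    rw [padicValInt.mul hm hn, pow_add]
  · by_cases hm : m = 0
    · simp [padicSeminorm, hm]
    by_cases hn : n = 0
    · simp [padicSeminorm, hn]
    by_cases hmn : m + n = 0
    · have : padicSeminorm p r (m + n) = 0 := by simp [padicSeminorm, hmn]
      rw [this]
      exact add_nonneg (hpos m) (hpos n)
    have hval : padicValInt p m ≤ padicValInt p (m + n) ∨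
        padicValInt p n ≤ padicValInt p (m + n) := by
      have h := padicValRat.min_le_padicValRat_add (p := p) (q := m) (r := n)
        (by exact_mod_cast hmn)
      rw [← Int.cast_add] at h
      simpa only [padicValRat.of_int, min_le_iff, Nat.cast_le] using h
    have hm' := pow_nonneg hr₀ (padicValInt p m)
    have hn' := pow_nonneg hr₀ (padicValInt p n)
    simp only [padicSeminorm, hm, hn, hmn, if_false]
    rcases hval with h | h <;> linarith [pow_le_pow_of_le_one hr₀ hr₁ h]
  · by_cases hn : n = 0
    · simp [padicSeminorm, hn]
    simp only [padicSeminorm, hn, if_false]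
    exact (pow_le_one₀ hr₀ hr₁).trans (one_le_abs_intCast hn)

theorem IsBerkSeminorm.eq_of_dvd_sub {x : ℤ → ℝ} (hx : IsBerkSeminorm x) {d a b : ℤ}
    (hd : x d = 0) (h : d ∣ a - b) : x a = x b := by
  obtain ⟨-, -, -, hmul, hadd, -⟩ := hx
  obtain ⟨c, hc⟩ := h
  have hab := hadd b (d * c)
  have hba := hadd a (d * -c)
  rw [hmul, hd, zero_mul, add_zero] at hab hba
  rw [show b + d * c = a by linarith] at hab
  rw [show a + d * -c = b by linarith] at hba
  exact le_antisymm hab hba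

theorem IsBerkSeminorm.exists_prime_of_zero {x : ℤ → ℝ} (hx : IsBerkSeminorm x) {n : ℤ}
    (hn : n ≠ 0) (hxn : x n = 0) : ∃ p : ℕ, p.Prime ∧ x p = 0 := by
  have hxn' : x n.natAbs = 0 := by
    rcases Int.natAbs_eq n with h | h
    · rwa [← h]
    · rw [show (n.natAbs : ℤ) = -1 * n by omega, hx.2.2.2.1, hxn, mul_zero]
  have key (k : ℕ) : k ≠ 0 → x k = 0 → ∃ p : ℕ, p.Prime ∧ x p = 0 := by
    induction k using Nat.recOnMul with
    | zero => exact fun h => absurd rfl h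
    | one =>
      intro _ h
      rw [Nat.cast_one, hx.2.1] at h
      exact absurd h one_ne_zero
    | prime p hp => exact fun _ h => ⟨p, hp, h⟩
    | mul a b iha ihb =>
      intro h0 h
      rw [Nat.cast_mul, hx.2.2.2.1, mul_eq_zero] at h
      exact h.elim (iha (left_ne_zero_of_mul h0)) (ihb (right_ne_zero_of_mul h0))
  exact key _ (Int.natAbs_ne_zero.mpr hn) hxn'

theorem IsBerkSeminorm.eq_padicSeminorm_zero {x : ℤ → ℝ} (hx : IsBerkSeminorm x) (p : ℕ)
    [hp : Fact p.Prime] (hxp : x p = 0) : padicSeminorm p 0 = x := by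
  have hpow (n : ℤ) (k : ℕ) : x (n ^ k) = x n ^ k := by
    induction k with
    | zero => simp [hx.2.1]
    | succ k ih => rw [pow_succ, hx.2.2.2.1, ih, pow_succ]
  funext n
  by_cases hn : n = 0
  · simp [padicSeminorm, hn, hx.1]
  by_cases hd : (p : ℤ) ∣ n
  · have hv : padicValInt p n ≠ 0 := by
      have := (padicValInt_dvd_iff (p := p) 1 n).mp (by simpa using hd)
      omega
    have hxn : x n = x 0 := hx.eq_of_dvd_sub hxp (by simpa using hd)
    simp [padicSeminorm, hn, hv, hxn, hx.1]
  · have hv : padicValInt p n = 0 := padicValInt.eq_zero_of_not_dvd hd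
    have hcop : IsCoprime n p :=
      ((Nat.prime_iff_prime_int.mp hp.out).coprime_iff_not_dvd.mpr hd).symm
    have hone : x (n ^ (p - 1)) = x 1 :=
      hx.eq_of_dvd_sub hxp (Int.ModEq.pow_card_sub_one_eq_one hp.out hcop).symm.dvd
    rw [hpow, hx.2.1,
      pow_eq_one_iff_of_nonneg (hx.2.2.1 n) (Nat.sub_pos_of_lt hp.out.one_lt).ne'] at hone
    simp [padicSeminorm, hn, hv, hone]

theorem joined_trivialSeminorm (x : BerkZ) :
    Joined (⟨trivialSeminorm, isBerkSeminorm_trivialSeminorm⟩ : BerkZ) x := by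
  obtain ⟨x, hx⟩ := x
  by_cases hker : ∀ n : ℤ, n ≠ 0 → x n ≠ 0
  · have h := joined_of_family (fun t => powSeminorm x t)
      (fun t => isBerkSeminorm_powSeminorm hx t.2.1 t.2.2) fun n => by
        by_cases hn : n = 0
        · simpa [powSeminorm, hn] using continuous_const
        · simpa [powSeminorm, hn] using
            (Real.continuous_const_rpow (hker n hn)).comp' continuous_subtype_val
    convert h using 2
    · funext n
      simp [powSeminorm, trivialSeminorm]
    · funext n
      by_cases hn : n = 0 <;> simp [powSeminorm, hn, hx.1]
  · push Not at hker
    obtain ⟨n, hn, hxn⟩ := hker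
    obtain ⟨p, hp, hxp⟩ := hx.exists_prime_of_zero hn hxn
    have : Fact p.Prime := ⟨hp⟩
    have h := joined_of_family (fun t => padicSeminorm p t)
      (fun t => isBerkSeminorm_padicSeminorm p t.2.1 t.2.2) fun n => by
        by_cases hn : n = 0
        · simpa [padicSeminorm, hn] using continuous_const
        · simp only [padicSeminorm, hn, if_false]
          fun_prop
    convert h.symm using 2
    · funext n
      simp [padicSeminorm, trivialSeminorm]
    · simpa using (hx.eq_padicSeminorm_zero p hxp).symm

/-- The Berkovich spectrum `M(ℤ)` is path-connected. -/
theorem berkZ_pathConnected : PathConnectedSpace BerkZ := by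
  exact ⟨⟨⟨trivialSeminorm, isBerkSeminorm_trivialSeminorm⟩⟩,
    fun x y => (joined_trivialSeminorm x).symm.trans (joined_trivialSeminorm y)⟩
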